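/- Let (e_k)_{k∈ℕ} denote the standard orthonormal basis of ℓ². Then sup over z ∈ ℓ² with ‖z‖ ≤ 6 of inf_{k∈ℕ} ‖z − 8e_k‖ equals 10. More precisely: (i) for every z ∈ ℓ² with ‖z‖ ≤ 6 one has inf_{k∈ℕ} ‖z − 8e_k‖ ≤ 10; and (ii) the point z = −6e₁ satisfies ‖z‖ = 6 and ‖z − 8e_k‖ ≥ 10 for every k ∈ ℕ. -/

import Mathlib

open MeasureTheory

/-- The Hilbert space ℓ² of square-summable real sequences. -/
noncomputable abbrev Hl2 : Type := lp (fun _ : ℕ => ℝ) 2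

/-- The standard orthonormal basis of ℓ². -/
noncomputable def stdBasis (k : ℕ) : Hl2 := lp.single 2 k (1 : ℝ)

theorem norm_stdBasis (k : ℕ) : ‖stdBasis k‖ = 1 := by
  simp [stdBasis, lp.norm_single]

theorem inner_stdBasis_right (z : Hl2) (k : ℕ) : inner ℝ z (stdBasis k) = z k := by
  simp [stdBasis, lp.inner_single_right]

theorem norm_sub_smul_stdBasis_sq (z : Hl2) (c : ℝ) (k : ℕ) :
    ‖z - c • stdBasis k‖ ^ 2 = ‖z‖ ^ 2 + c ^ 2 - 2 * c * z k := by
  rw [norm_sub_sq_real, real_inner_smul_right, inner_stdBasis_right, norm_smul, norm_stdBasis,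
    mul_one, Real.norm_eq_abs, sq_abs]
  ring

theorem tendsto_coord_zero (z : Hl2) :
    Filter.Tendsto (fun k => z k) Filter.atTop (nhds 0) := by
  have h := (lp.summable_inner (𝕜 := ℝ) z z).tendsto_atTop_zero
  simp only [real_inner_self_eq_norm_sq] at h
  rw [tendsto_zero_iff_norm_tendsto_zero]
  simpa [Real.sqrt_sq_eq_abs] using h.sqrt

theorem tendsto_norm_sub_smul_stdBasis (z : Hl2) (c : ℝ) :
    Filter.Tendsto (fun k => ‖z - c • stdBasis k‖) Filter.atTop
      (nhds √(‖z‖ ^ 2 + c ^ 2)) := by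
  have h := (((tendsto_coord_zero z).const_mul (2 * c)).const_sub (‖z‖ ^ 2 + c ^ 2)).sqrt
  simpa only [← norm_sub_smul_stdBasis_sq, Real.sqrt_sq (norm_nonneg _), mul_zero,
    sub_zero] using h

theorem bddBelow_range_norm_sub_smul_stdBasis (z : Hl2) (c : ℝ) :
    BddBelow (Set.range fun k => ‖z - c • stdBasis k‖) :=
  ⟨0, Set.forall_mem_range.2 fun _ => norm_nonneg _⟩

theorem iInf_norm_sub_smul_stdBasis_le (z : Hl2) (c : ℝ) :
    ⨅ k, ‖z - c • stdBasis k‖ ≤ √(‖z‖ ^ 2 + c ^ 2) :=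
  ge_of_tendsto' (tendsto_norm_sub_smul_stdBasis z c)
    fun k => ciInf_le (bddBelow_range_norm_sub_smul_stdBasis z c) k

/-- Example of the paper (pursuers with geometric constraints): with pursuers at `8e_k` the
farthest-point value over the ball `B(0,6)` is `10`; every point of the ball is within `10`
of some `8e_k`, while `z = -6e₁` realizes the value. -/
theorem example_geometric_constraint_value :
    (⨆ z : {z : Hl2 // ‖z‖ ≤ 6}, ⨅ k : ℕ, ‖(z : Hl2) - (8:ℝ) • stdBasis k‖) = 10 ∧
    (∀ z : Hl2, ‖z‖ ≤ 6 → (⨅ k : ℕ, ‖z - (8:ℝ) • stdBasis k‖) ≤ 10) ∧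
    (‖(-6:ℝ) • stdBasis 0‖ = 6 ∧
      ∀ k : ℕ, (10:ℝ) ≤ ‖(-6:ℝ) • stdBasis 0 - (8:ℝ) • stdBasis k‖) := by
  have upper (z : Hl2) (hz : ‖z‖ ≤ 6) : ⨅ k : ℕ, ‖z - (8:ℝ) • stdBasis k‖ ≤ 10 := by
    refine (iInf_norm_sub_smul_stdBasis_le z 8).trans (Real.sqrt_le_iff.2 ⟨by norm_num, ?_⟩)
    nlinarith [norm_nonneg z]
  have norm_eq : ‖(-6:ℝ) • stdBasis 0‖ = 6 := by
    rw [norm_smul, norm_stdBasis]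
    norm_num
  have lower (k : ℕ) : (10:ℝ) ≤ ‖(-6:ℝ) • stdBasis 0 - (8:ℝ) • stdBasis k‖ := by
    have coord : ((-6:ℝ) • stdBasis 0 : Hl2) k ≤ 0 := by
      have nonneg : 0 ≤ stdBasis 0 k := by
        rw [stdBasis, lp.single_apply]
        exact (Pi.single_nonneg.2 zero_le_one : (0 : ℕ → ℝ) ≤ Pi.single 0 1) k
      rw [lp.coeFn_smul, Pi.smul_apply, smul_eq_mul]
      linarith
    refine (sq_le_sq₀ (by norm_num) (norm_nonneg _)).1 ?_
    rw [norm_sub_smul_stdBasis_sq, norm_eq]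
    linarith
  refine ⟨le_antisymm ?_ ?_, upper, norm_eq, lower⟩
  · have : Nonempty {z : Hl2 // ‖z‖ ≤ 6} := ⟨⟨_, norm_eq.le⟩⟩
    exact ciSup_le fun z => upper z z.2
  · exact (le_ciInf lower).trans (le_ciSup
      (f := fun z : {z : Hl2 // ‖z‖ ≤ 6} => ⨅ k : ℕ, ‖(z : Hl2) - (8:ℝ) • stdBasis k‖)
      ⟨10, Set.forall_mem_range.2 fun z => upper z z.2⟩ ⟨_, norm_eq.le⟩)
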